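/- Define R_n(\lambda(x); \alpha,\beta,\gamma,\delta) = \sum_{k=0}^n ((-n)_k (n+\alpha+\beta+1)_k (-x)_k (x+\gamma+\delta+1)_k) / ((\alpha+1)_k (\beta+\delta+1)_k (\gamma+1)_k k!), where (a)_k denotes the Pochhammer symbol. Then for a natural number x and complex parameters (with no vanishing denominators), ((x+\gamma+1)(x+\beta+\delta)/(2x+\gamma+\delta+1)) R_n(\lambda(x+1); \alpha,\beta,\gamma,\delta-1) - ((x-\beta+\gamma+1)(x+\delta)/(2x+\gamma+\delta+1)) R_n(\lambda(x); \alpha,\beta,\gamma,\delta-1) = ((n+\alpha+1)(n+\beta)/(\alpha+1)) R_n(\lambda(x); \alpha+1,\beta-1,\gamma,\delta). -/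

import Mathlib

open Finset

noncomputable def poch (a : ℂ) (k : ℕ) : ℂ := (ascPochhammer ℂ k).eval a

/-- Racah polynomial as terminating ₄F₃ sum. -/
noncomputable def racah (n : ℕ) (x α β γ δ : ℂ) : ℂ :=
  ∑ k ∈ range (n + 1),
    poch (-(n : ℂ)) k * poch ((n : ℂ) + α + β + 1) k * poch (-x) k * poch (x + γ + δ + 1) k /
      (poch (α + 1) k * poch (β + δ + 1) k * poch (γ + 1) k * (k.factorial : ℂ))

lemma poch_zero (a : ℂ) : poch a 0 = 1 := by simp [poch]

lemma poch_succ (a : ℂ) (k : ℕ) : poch a (k + 1) = poch a k * (a + k) := by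
  simp [poch, ascPochhammer_succ_eval]

lemma poch_succ_left (a : ℂ) (k : ℕ) : poch a (k + 1) = a * poch (a + 1) k := by
  simp [poch, ascPochhammer_succ_left]

lemma add_natCast_ne_zero_of_poch {a : ℂ} {k : ℕ} (h : poch a (k + 1) ≠ 0) : a + k ≠ 0 := by
  rw [poch_succ] at h
  exact right_ne_zero_of_mul h

/-- The `k`-th term of the Racah sum, with an arbitrary value `N` in place of the degree. -/
noncomputable def racahTerm (N x α β γ δ : ℂ) (k : ℕ) : ℂ :=
  poch (-N) k * poch (N + α + β + 1) k * poch (-x) k * poch (x + γ + δ + 1) k /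
    (poch (α + 1) k * poch (β + δ + 1) k * poch (γ + 1) k * (k.factorial : ℂ))

/-- Partial sums of the termwise difference relation telescope. -/
lemma sum_racahTerm_difference (N x α β γ δ : ℂ) (hden : 2 * x + γ + δ + 1 ≠ 0) (m : ℕ)
    (h1 : ∀ k ≤ m + 1, poch (α + 1) k ≠ 0) (h2 : ∀ k ≤ m, poch (β + δ) k ≠ 0)
    (h3 : ∀ k ≤ m, poch (γ + 1) k ≠ 0) :
    ∑ k ∈ range (m + 1),
      ((x + γ + 1) * (x + β + δ) / (2 * x + γ + δ + 1) * racahTerm N (x + 1) α β γ (δ - 1) k -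
        (x - β + γ + 1) * (x + δ) / (2 * x + γ + δ + 1) * racahTerm N x α β γ (δ - 1) k -
        (N + α + 1) * (N + β) / (α + 1) * racahTerm N x (α + 1) (β - 1) γ δ k) =
    poch (-N) m * poch (N + α + β + 1) m * poch (-x) m * poch (x + γ + δ + 1) m /
      (poch (α + 1) m * poch (β + δ) m * poch (γ + 1) m * (m.factorial : ℂ)) *
      ((m - N) * (N + α + β + 1 + m) / (α + 1 + m)) := by
  have hα : α + 1 ≠ 0 := by simpa [poch_succ, poch_zero] using h1 1 (by omega)
  induction m with
  | zero =>
    simp only [zero_add, sum_range_one, racahTerm, poch_zero, Nat.factorial_zero, Nat.cast_one,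
      Nat.cast_zero, add_zero]
    generalize hD : 2 * x + γ + δ + 1 = D at *
    field_simp
    rw [← hD]
    ring
  | succ m ih =>
    rw [sum_range_succ, ih (fun k hk => h1 k (by omega)) (fun k hk => h2 k (by omega))
      (fun k hk => h3 k (by omega))]
    have a0 := h1 m (by omega)
    have a1 := add_natCast_ne_zero_of_poch (h1 (m + 1) (by omega))
    have a2 := add_natCast_ne_zero_of_poch (h1 (m + 1 + 1) (by omega))
    have b0 := h2 m (by omega)
    have b1 := add_natCast_ne_zero_of_poch (h2 (m + 1) le_rfl)
    have c0 := h3 m (by omega)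
    have c1 := add_natCast_ne_zero_of_poch (h3 (m + 1) le_rfl)
    have f0 : (m.factorial : ℂ) ≠ 0 := by exact_mod_cast m.factorial_ne_zero
    have f1 : (m : ℂ) + 1 ≠ 0 := by exact_mod_cast m.succ_ne_zero
    have e1 : poch (-(x + 1)) (m + 1) = -(x + 1) * poch (-x) m := by
      rw [poch_succ_left]; congr 2; ring
    have e2 : poch (x + 1 + γ + (δ - 1) + 1) (m + 1) =
        poch (x + γ + δ + 1) m * (x + γ + δ + 1 + m) := by
      rw [← poch_succ]; congr 1; ring
    have e3 : poch (x + γ + (δ - 1) + 1) (m + 1) = (x + γ + δ) * poch (x + γ + δ + 1) m := by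
      rw [poch_succ_left]; ring_nf
    have e4 : poch (α + 1 + 1) (m + 1) =
        poch (α + 1) m * (α + 1 + m) * (α + 1 + (m + 1 : ℕ)) / (α + 1) := by
      rw [← poch_succ, ← poch_succ, poch_succ_left (α + 1) (m + 1)]
      field_simp
    have e5 : β + (δ - 1) + 1 = β + δ := by ring
    have e6 : β - 1 + δ + 1 = β + δ := by ring
    have e7 : N + (α + 1) + (β - 1) + 1 = N + α + β + 1 := by ring
    simp only [racahTerm, e1, e2, e3, e4, e5, e6, e7, Nat.factorial_succ]
    simp only [poch_succ]
    push_cast at a2 ⊢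
    generalize poch (-N) m = P1, poch (N + α + β + 1) m = P2, poch (-x) m = P3,
      poch (x + γ + δ + 1) m = P4
    generalize poch (α + 1) m = A at *
    generalize poch (β + δ) m = B at *
    generalize poch (γ + 1) m = C at *
    generalize (m.factorial : ℂ) = F at *
    generalize (m : ℂ) = M at *
    generalize hD : 2 * x + γ + δ + 1 = D at *
    generalize hA1 : α + 1 + M = A1 at *
    generalize hA2 : α + 1 + (M + 1) = A2 at *
    generalize hA0 : α + 1 = A0 at *
    generalize hB1 : β + δ + M = B1 at *
    generalize hC1 : γ + 1 + M = C1 at *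
    generalize hF1 : M + 1 = F1 at *
    field_simp
    subst hD hA1 hA2 hB1 hC1 hF1 hA0
    ring

theorem racah_difference_eq1 (n x : ℕ) (α β γ δ : ℂ)
    (hden : 2 * (x : ℂ) + γ + δ + 1 ≠ 0) (hα : α + 1 ≠ 0)
    (h1 : ∀ k ≤ n, poch (α + 1) k ≠ 0) (h2 : ∀ k ≤ n, poch (β + δ) k ≠ 0)
    (h3 : ∀ k ≤ n, poch (γ + 1) k ≠ 0) (h4 : ∀ k ≤ n, poch (α + 2) k ≠ 0) :
    ((x : ℂ) + γ + 1) * ((x : ℂ) + β + δ) / (2 * (x : ℂ) + γ + δ + 1) *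
        racah n ((x : ℂ) + 1) α β γ (δ - 1) -
      ((x : ℂ) - β + γ + 1) * ((x : ℂ) + δ) / (2 * (x : ℂ) + γ + δ + 1) *
        racah n (x : ℂ) α β γ (δ - 1) =
    ((n : ℂ) + α + 1) * ((n : ℂ) + β) / (α + 1) * racah n (x : ℂ) (α + 1) (β - 1) γ δ := by
  have h1' : ∀ k ≤ n + 1, poch (α + 1) k ≠ 0 := by
    rintro (_ | k) hk
    · simp [poch_zero]
    · rw [poch_succ_left, show α + 1 + 1 = α + 2 by ring]
      exact mul_ne_zero hα (h4 k (by omega))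
  have key := sum_racahTerm_difference n x α β γ δ hden n h1' h2 h3
  rw [sub_self, zero_mul, zero_div, mul_zero, sum_sub_distrib, sum_sub_distrib, ← mul_sum,
    ← mul_sum, ← mul_sum] at key
  exact sub_eq_zero.mp key
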